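/- Let Ω ⊆ ℝ^d be an open convex set and f : Ω → ℝ a continuous function. Then f has bounded finite differences of order k (i.e., there is C with ‖Δ^k_u f(x)‖ ≤ C‖u₁‖⋯‖u_k‖ whenever all points x+α·u lie in Ω) if and only if f is of class C^{k−1} with D^{k−1}f Lipschitz; moreover the least such constant C equals Lip(D^{k−1}f). -/

import Mathlib

open Finset

/-- The finite difference of order `k`:
`Δ^k_u f (x) = ∑_{α ∈ {0,1}^k} (-1)^{k-|α|} f (x + α·u)`. -/
def fdiff {X Y : Type*} [AddCommGroup X] [AddCommGroup Y] {k : ℕ}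
    (u : Fin k → X) (f : X → Y) (x : X) : Y :=
  ∑ α : Fin k → Bool,
    ((-1 : ℤ) ^ (k - (Finset.univ.filter fun i => α i).card)) •
      f (x + ∑ i, if α i then u i else 0)

def Cube {E : Type*} [AddCommGroup E] {k : ℕ} (u : Fin k → E) (x : E) (S : Set E) : Prop :=
  ∀ α : Fin k → Bool, x + ∑ i, (if α i then u i else 0) ∈ S

lemma fdiff_cons {X Y : Type*} [AddCommGroup X] [AddCommGroup Y] {k : ℕ}
    (v : X) (u : Fin k → X) (f : X → Y) (x : X) :
    fdiff (Fin.cons v u : Fin (k+1) → X) f x = fdiff u f (x + v) - fdiff u f x := by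
  unfold fdiff
  rw [← (Fin.consEquiv (fun _ : Fin (k+1) => Bool)).sum_comp, Fintype.sum_prod_type]
  simp only [Fintype.sum_bool, Fin.consEquiv_apply, Fin.sum_univ_succ, Fin.cons_zero, Fin.cons_succ]
  have h1 : ∀ (b : Bool) (α : Fin k → Bool),
      (Finset.univ.filter fun i : Fin (k+1) => (Fin.cons b α : Fin (k+1) → Bool) i = true).card
        = (if b then 1 else 0) + (Finset.univ.filter fun i => α i = true).card := by
    intro b α
    rw [Fin.card_filter_univ_succ]
    cases b <;> simp [add_comm]
  have h2 : ∀ α : Fin k → Bool, (Finset.univ.filter fun i => α i = true).card ≤ k := by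
    intro α
    exact (Finset.card_le_univ _).trans (by simp)
  rw [sub_eq_add_neg, ← Finset.sum_neg_distrib]
  congr 1
  · refine Finset.sum_congr rfl fun α _ => ?_
    rw [h1]
    simp only [if_true]
    rw [show k + 1 - (1 + (Finset.univ.filter fun i => α i = true).card) =
      k - (Finset.univ.filter fun i => α i = true).card by omega, add_assoc]
  · refine Finset.sum_congr rfl fun α _ => ?_
    rw [h1]
    have := h2 α
    rw [show k + 1 - ((if false = true then 1 else 0) + (Finset.univ.filter fun i => α i = true).card) =
      k - (Finset.univ.filter fun i => α i = true).card + 1 by simp; omega]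
    simp [pow_succ]

lemma fdiff_sub_shift {X Y : Type*} [AddCommGroup X] [AddCommGroup Y] {k : ℕ}
    (v : X) (u : Fin k → X) (f : X → Y) (x : X) :
    fdiff u (fun y => f (y + v) - f y) x = fdiff u f (x + v) - fdiff u f x := by
  unfold fdiff
  rw [← Finset.sum_sub_distrib]
  refine Finset.sum_congr rfl fun α _ => ?_
  rw [smul_sub, add_right_comm]

lemma cube_cons {E : Type*} [AddCommGroup E] {k : ℕ} {v : E} {u : Fin k → E} {x : E} {S : Set E} :
    Cube (Fin.cons v u : Fin (k+1) → E) x S ↔ Cube u (x + v) S ∧ Cube u x S := by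
  unfold Cube
  constructor
  · intro h
    constructor
    · intro α
      simpa [Fin.sum_univ_succ, add_assoc] using h (Fin.cons true α)
    · intro α
      simpa [Fin.sum_univ_succ, add_assoc] using h (Fin.cons false α)
  · rintro ⟨h1, h2⟩ α
    obtain ⟨b, β, rfl⟩ : ∃ b β, α = Fin.cons b β := ⟨α 0, Fin.tail α, (Fin.cons_self_tail α).symm⟩
    cases b
    · simpa [Fin.sum_univ_succ, add_assoc] using h2 β
    · simpa [Fin.sum_univ_succ, add_assoc] using h1 β

lemma Cube.base {E : Type*} [AddCommGroup E] {k : ℕ} {u : Fin k → E} {x : E} {S : Set E}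
    (h : Cube u x S) : x ∈ S := by simpa using h (fun _ => false)

lemma Cube.mono {E : Type*} [AddCommGroup E] {k : ℕ} {u : Fin k → E} {x : E} {S T : Set E}
    (h : Cube u x S) (hST : S ⊆ T) : Cube u x T := fun α => hST (h α)

set_option linter.unusedSectionVars false
section
variable {E : Type*} [NormedAddCommGroup E] [NormedSpace ℝ E]

def BD (k : ℕ) (C : ℝ) (S : Set E) (f : E → ℝ) : Prop :=
  ∀ (u : Fin k → E) (x : E), Cube u x S → |fdiff u f x| ≤ C * ∏ i, ‖u i‖

lemma BD.cons {k : ℕ} {C : ℝ} {S : Set E} {f : E → ℝ} (h : BD (k+1) C S f) {v : E} {u : Fin k → E}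
    {x : E} (h1 : Cube u (x + v) S) (h2 : Cube u x S) :
    |fdiff u f (x + v) - fdiff u f x| ≤ C * (‖v‖ * ∏ i, ‖u i‖) := by
  have := h (Fin.cons v u) x (cube_cons.2 ⟨h1, h2⟩)
  rw [fdiff_cons] at this
  simpa [Fin.prod_univ_succ] using this

lemma BD.of_cons {k : ℕ} {C : ℝ} {S : Set E} {f : E → ℝ}
    (h : ∀ (v : E) (u : Fin k → E) (x : E), Cube u (x + v) S → Cube u x S →
      |fdiff u f (x + v) - fdiff u f x| ≤ C * (‖v‖ * ∏ i, ‖u i‖)) : BD (k+1) C S f := by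
  intro u x hu
  obtain ⟨v, w, rfl⟩ : ∃ v w, u = Fin.cons v w := ⟨u 0, Fin.tail u, (Fin.cons_self_tail u).symm⟩
  rw [fdiff_cons]
  rw [cube_cons] at hu
  simpa [Fin.prod_univ_succ] using h v w x hu.1 hu.2

lemma fdiff_zero (u : Fin 0 → E) (f : E → ℝ) (x : E) : fdiff u f x = f x := by
  simp [fdiff]

lemma BD.mono {k : ℕ} {C : ℝ} {S T : Set E} {f : E → ℝ} (h : BD k C T f) (hST : S ⊆ T) :
    BD k C S f := fun u x hu => h u x (hu.mono hST)

lemma BD.congr {k : ℕ} {C : ℝ} {S : Set E} {f g : E → ℝ} (h : BD k C S f)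
    (hfg : ∀ x ∈ S, f x = g x) : BD k C S g := by
  intro u x hu
  have : fdiff u g x = fdiff u f x := by
    unfold fdiff
    refine Finset.sum_congr rfl fun α _ => ?_
    rw [hfg _ (hu α)]
  rw [this]
  exact h u x hu

lemma hasDerivAt_fdiff {k : ℕ} {f : E → ℝ} {u : Fin k → E} {x v : E} {t : ℝ} {S : Set E}
    (hS : ∀ y ∈ S, DifferentiableAt ℝ f y) (hu : Cube u (x + t • v) S) :
    HasDerivAt (fun s : ℝ => fdiff u f (x + s • v))
      (fdiff u (fun y => fderiv ℝ f y v) (x + t • v)) t := by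
  unfold fdiff
  refine HasDerivAt.fun_sum fun α _ => ?_
  refine HasDerivAt.const_smul (R := ℤ) _ ?_
  have h1 := (hS _ (hu α)).hasFDerivAt
  have h2 : HasDerivAt (fun s : ℝ => x + s • v + ∑ i, if α i then u i else 0) v t := by
    simpa using (((hasDerivAt_id t).smul_const v).const_add x).add_const
      (∑ i, if α i then u i else 0)
  exact h1.comp_hasDerivAt t h2

lemma BD.fderiv {k : ℕ} {C : ℝ} (hC : 0 ≤ C) {S : Set E} {f : E → ℝ} (hS : IsOpen S)
    (hd : ∀ y ∈ S, DifferentiableAt ℝ f y) (h : BD (k+1) C S f) (v : E) :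
    BD k (C * ‖v‖) S (fun y => fderiv ℝ f y v) := by
  intro u x hu
  have h1 := hasDerivAt_fdiff (v := v) (t := 0) hd (by simpa using hu)
  have hev : ∀ᶠ s : ℝ in nhds 0, Cube u (x + s • v) S := by
    unfold Cube
    rw [Filter.eventually_all]
    intro α
    have hc : ContinuousAt (fun s : ℝ => x + s • v + ∑ i, if α i then u i else 0) 0 := by fun_prop
    exact hc.eventually_mem (hS.mem_nhds (by simpa using hu α))
  have h2 := h1.le_of_lip' (C := C * ‖v‖ * ∏ i, ‖u i‖) (by positivity) (by
    filter_upwards [hev] with s hs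
    have := h.cons hs hu
    simp only [Real.norm_eq_abs, zero_smul, add_zero, sub_zero]
    rw [norm_smul] at this
    refine this.trans_eq ?_
    rw [Real.norm_eq_abs]; ring)
  simpa using h2

lemma BD.continuousOn {C : ℝ} (hC : 0 ≤ C) {S : Set E} {f : E → ℝ} (h : BD 1 C S f) :
    ContinuousOn f S := by
  have : LipschitzOnWith ⟨C, hC⟩ f S := by
    refine LipschitzOnWith.of_dist_le_mul fun x hx y hy => ?_
    have := h.cons (v := x - y) (u := Fin.elim0) (x := y) (by intro α; simpa using hx)
      (by intro α; simpa using hy)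
    simp only [fdiff_zero] at this
    change dist (f x) (f y) ≤ C * dist x y
    simpa [dist_eq_norm] using this
  exact this.continuousOn

/-- dyadic lemma -/
lemma dyadic {G : E → ℝ} {y : E} {ρ M C : ℝ} (hρ : 0 < ρ) (hM : 0 ≤ M) (hC : 0 ≤ C)
    (h1 : ∀ v : E, ‖v‖ ≤ ρ → |G (y + v) - G y| ≤ M)
    (h2 : ∀ v : E, ‖v‖ + ‖v‖ ≤ ρ → |(G (y + v + v) - G (y + v)) - (G (y + v) - G y)| ≤ C * ‖v‖ ^ 2)
    (v : E) (hv : ‖v‖ ≤ ρ) : |G (y + v) - G y| ≤ (2 / ρ * M + C * ρ) * ‖v‖ := by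
  have key : ∀ n : ℕ, ∀ v : E, ‖v‖ ≤ (1/2)^n * ρ →
      |G (y + v) - G y| ≤ (1/2)^n * M + C * ‖v‖ * (ρ - ‖v‖) := by
    intro n
    induction n with
    | zero =>
      intro v hv
      have hv' : ‖v‖ ≤ ρ := by simpa using hv
      have := h1 v hv'
      have h3 : 0 ≤ C * ‖v‖ * (ρ - ‖v‖) := mul_nonneg (by positivity) (by linarith)
      simp; linarith
    | succ n ih =>
      intro v hv
      have hp : ((1:ℝ)/2)^n ≤ 1 := pow_le_one₀ (by norm_num) (by norm_num)
      have hnv : ‖v + v‖ = 2 * ‖v‖ := by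
        rw [← two_smul ℝ v, norm_smul]; simp
      rw [pow_succ] at hv ⊢
      have a := ih (v + v) (by rw [hnv]; linarith)
      have b := h2 v (by nlinarith)
      rw [hnv, ← add_assoc] at a
      have : |G (y + v) - G y| ≤ 1/2 * |G (y + v + v) - G y| +
          1/2 * |(G (y + v + v) - G (y + v)) - (G (y + v) - G y)| := by
        have e : G (y + v) - G y = 1/2 * (G (y + v + v) - G y) -
          1/2 * ((G (y + v + v) - G (y + v)) - (G (y + v) - G y)) := by ring
        have e2 := abs_sub (1/2 * (G (y + v + v) - G y))
          (1/2 * ((G (y + v + v) - G (y + v)) - (G (y + v) - G y)))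
        rw [← e, abs_mul, abs_mul, abs_of_pos (by norm_num : (0:ℝ) < 1/2)] at e2
        exact e2
      have h5 : 0 ≤ C * ‖v‖^2 := by positivity
      nlinarith
  rcases eq_or_ne v 0 with rfl | hv0
  · simp
  have hvp : 0 < ‖v‖ := norm_pos_iff.2 hv0
  obtain ⟨n, hn1, hn2⟩ := exists_nat_pow_near_of_lt_one (x := ‖v‖ / ρ) (y := (1/2 : ℝ))
    (by positivity) (by rw [div_le_one hρ]; exact hv) (by norm_num) (by norm_num)
  have hn1' : (1/2)^(n+1) * ρ < ‖v‖ := by rwa [lt_div_iff₀ hρ] at hn1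
  have hn2' : ‖v‖ ≤ (1/2)^n * ρ := by rwa [div_le_iff₀ hρ] at hn2
  refine (key n v hn2').trans ?_
  have h6 : ((1:ℝ)/2)^n ≤ 2 / ρ * ‖v‖ := by
    rw [pow_succ] at hn1'
    rw [div_mul_eq_mul_div, le_div_iff₀ hρ]; linarith
  have h7 := mul_le_mul_of_nonneg_right h6 hM
  have h5 : 0 ≤ C * ‖v‖^2 := by positivity
  nlinarith

lemma Cube.shift {k : ℕ} {u : Fin k → E} {x c w : E} {a r : ℝ} (h : Cube u x (Metric.ball c a))
    (hr : a + ‖w‖ ≤ r) : Cube u (x + w) (Metric.ball c r) := by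
  intro α
  have := h α
  rw [mem_ball_iff_norm] at this ⊢
  rw [show x + w + ∑ i, (if α i then u i else 0) - c
    = (x + ∑ i, (if α i then u i else 0) - c) + w by abel]
  exact (norm_add_le _ _).trans_lt (by linarith)

lemma marchaud (k : ℕ) : ∀ r : ℝ, 0 < r → ∃ r' : ℝ, 0 < r' ∧ r' ≤ r ∧ ∃ A : ℝ, 0 ≤ A ∧
    ∀ (c : E) (f : E → ℝ) (M C : ℝ), 0 ≤ M → 0 ≤ C → (∀ y ∈ Metric.ball c r, |f y| ≤ M) →
      BD (k+1) C (Metric.ball c r) f → BD k (A * (M + C)) (Metric.ball c r') f := by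
  induction k with
  | zero =>
    intro r hr
    refine ⟨r, hr, le_rfl, 1, zero_le_one, ?_⟩
    intro c f M C hM hC hb _ u x hu
    rw [fdiff_zero]
    have := hb x hu.base
    simp; linarith
  | succ k ih =>
    intro r hr
    obtain ⟨r1, hr1, hr1r, A, hA, H⟩ := ih (r/2) (by linarith)
    obtain ⟨ρ, hρ⟩ : ∃ ρ, ρ = r / 2 := ⟨_, rfl⟩
    have hρ0 : 0 < ρ := by rw [hρ]; linarith
    refine ⟨min r1 (r/4), lt_min hr1 (by linarith), (min_le_left _ _).trans (by linarith),
      2 / ρ * A * (2 + ρ) + ρ, by positivity, ?_⟩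
    intro c f M C hM hC hb h
    refine BD.of_cons ?_
    intro v u x h1 h2
    have hP : 0 ≤ ∏ i, ‖u i‖ := by positivity
    set P := ∏ i, ‖u i‖ with hPdef
    have h2a : Cube u x (Metric.ball c (r/4)) := h2.mono (Metric.ball_subset_ball (min_le_right _ _))
    have h2b : Cube u x (Metric.ball c r1) := h2.mono (Metric.ball_subset_ball (min_le_left _ _))
    have hv : ‖v‖ ≤ ρ := by
      have e1 := h1.base
      have e2 := h2.base
      rw [mem_ball_iff_norm] at e1 e2
      have := norm_sub_le (x + v - c) (x - c)
      rw [show x + v - c - (x - c) = v by abel] at this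
      have := min_le_right r1 (r/4)
      linarith
    have key := dyadic (G := fdiff u f) (y := x) (ρ := ρ) (M := A * (2 * M + C * ρ) * P) (C := C * P)
      hρ0 (by positivity) (by positivity) ?_ ?_ v hv
    · refine key.trans ?_
      have e1 : 2 / ρ * A * (2 * M + C * ρ) ≤ 2 / ρ * A * ((2 + ρ) * (M + C)) :=
        mul_le_mul_of_nonneg_left (by nlinarith) (by positivity)
      have e2 : C * ρ ≤ ρ * (M + C) := by nlinarith
      have e3 : 0 ≤ P * ‖v‖ := by positivity
      have e4 := mul_le_mul_of_nonneg_right (add_le_add e1 e2) e3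
      linarith
    · intro w hw
      have g := H c (fun y => f (y + w) - f y) (2 * M) (C * ρ) (by positivity) (by positivity) ?_ ?_ u x h2b
      · rwa [fdiff_sub_shift] at g
      · intro y hy
        have hy2 : y + w ∈ Metric.ball c r := by
          rw [mem_ball_iff_norm] at hy ⊢
          rw [show y + w - c = (y - c) + w by abel]
          exact (norm_add_le _ _).trans_lt (by linarith)
        have a1 := hb _ hy2
        have a2 := hb y (Metric.ball_subset_ball (by linarith) hy)
        have := abs_sub (f (y + w)) (f y)
        linarith
      · intro u' y hu'
        rw [fdiff_sub_shift]
        refine (h.cons (hu'.shift (by linarith)) (hu'.mono (Metric.ball_subset_ball (by linarith)))).trans ?_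
        rw [mul_assoc]
        gcongr
    · intro w hw
      have s0 : Cube u x (Metric.ball c r) := h2a.mono (Metric.ball_subset_ball (by linarith))
      have s1 : Cube u (x + w) (Metric.ball c r) := h2a.shift (by linarith [norm_nonneg w])
      have s2 : Cube u (x + w + w) (Metric.ball c r) := by
        rw [add_assoc]
        exact h2a.shift (by linarith [norm_add_le w w])
      have g := BD.cons (k := k+1) (u := (Fin.cons w u : Fin (k+1) → E)) (v := w) (x := x) h
        (cube_cons.2 ⟨s2, s1⟩) (cube_cons.2 ⟨s1, s0⟩)
      rw [fdiff_cons, fdiff_cons, Fin.prod_univ_succ] at g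
      simp only [Fin.cons_zero, Fin.cons_succ] at g
      refine g.trans_eq ?_
      rw [hPdef]; ring

lemma down_to_two (j : ℕ) : ∀ (r : ℝ) (c : E) (f : E → ℝ) (M C : ℝ), 0 < r → 0 ≤ M → 0 ≤ C →
    (∀ y ∈ Metric.ball c r, |f y| ≤ M) → BD (j+2) C (Metric.ball c r) f →
    ∃ r' : ℝ, 0 < r' ∧ r' ≤ r ∧ ∃ C' : ℝ, 0 ≤ C' ∧ BD 2 C' (Metric.ball c r') f := by
  induction j with
  | zero =>
    intro r c f M C hr hM hC _ h
    exact ⟨r, hr, le_rfl, C, hC, h⟩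
  | succ j ih =>
    intro r c f M C hr hM hC hb h
    obtain ⟨r1, hr1, hr1r, A, hA, H⟩ := marchaud (E := E) (j+2) r hr
    obtain ⟨r2, h1, h2, C', h3, h4⟩ := ih r1 c f M (A * (M + C)) hr1 hM (by positivity)
      (fun y hy => hb y (Metric.ball_subset_ball hr1r hy)) (H c f M C hM hC hb h)
    exact ⟨r2, h1, h2.trans hr1r, C', h3, h4⟩

lemma BD.two {C : ℝ} {S : Set E} {f : E → ℝ} (h : BD 2 C S f) {x u v : E} (h0 : x ∈ S)
    (h1 : x + u ∈ S) (h2 : x + v ∈ S) (h3 : x + u + v ∈ S) :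
    |f (x + u + v) - f (x + u) - (f (x + v) - f x)| ≤ C * (‖u‖ * ‖v‖) := by
  have c0 : ∀ y ∈ S, Cube (Fin.elim0 : Fin 0 → E) y S := fun y hy α => by simpa using hy
  have g := BD.cons (k := 1) (u := (Fin.cons v Fin.elim0 : Fin 1 → E)) (v := u) (x := x) h
        (cube_cons.2 ⟨c0 _ h3, c0 _ h1⟩) (cube_cons.2 ⟨c0 _ h2, c0 _ h0⟩)
  rw [fdiff_cons, fdiff_cons, Fin.prod_univ_succ] at g
  simpa [fdiff_zero] using g

open Filter Topology in
lemma differentiableAt_of_two {r C : ℝ} (hr : 0 < r) (hC : 0 ≤ C) {c : E} {f : E → ℝ}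
    (hf : ContinuousAt f c) (h : BD 2 C (Metric.ball c r) f) : DifferentiableAt ℝ f c := by
  have hb : ∀ u : E, ‖u‖ < r → c + u ∈ Metric.ball c r := fun u hu => by
    simpa [mem_ball_iff_norm] using hu
  let q : E → ℕ → ℝ := fun u n => 2^n * (f (c + ((1/2:ℝ)^n) • u) - f c)
  have hsc : ∀ (u : E) (n : ℕ), ‖((1/2:ℝ)^n) • u‖ = (1/2)^n * ‖u‖ := fun u n => by
    rw [norm_smul]; simp
  have h12 : ∀ n : ℕ, ((1:ℝ)/2)^n * 2^n = 1 := fun n => by rw [← mul_pow]; norm_num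
  have hstep : ∀ u : E, ‖u‖ < r → ∀ n, dist (q u n) (q u (n+1)) ≤ (C * ‖u‖^2) / 2 / 2^n := by
    intro u hu n
    set w := ((1/2:ℝ)^(n+1)) • u with hw
    have hww : ((1/2:ℝ)^n) • u = w + w := by
      rw [hw, ← add_smul]; congr 1; rw [pow_succ]; ring
    have hpn : ((1:ℝ)/2)^n ≤ 1 := pow_le_one₀ (by norm_num) (by norm_num)
    have hwn : ‖w‖ = (1/2)^(n+1) * ‖u‖ := hsc u (n+1)
    have hwn2 : ‖w + w‖ < r := by
      rw [← hww, hsc]; nlinarith [norm_nonneg u]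
    have hwn1 : ‖w‖ < r := by
      rw [hwn, pow_succ]; nlinarith [norm_nonneg u]
    have := h.two (x := c) (u := w) (v := w) (by simpa using hr) (hb _ hwn1) (hb _ hwn1)
      (by rw [add_assoc]; exact hb _ hwn2)
    have e : q u n - q u (n+1) = 2^n * (f (c + w + w) - f (c + w) - (f (c + w) - f c)) := by
      simp only [q]; rw [hww, ← hw, pow_succ, ← add_assoc]; ring
    rw [Real.dist_eq, e, abs_mul, abs_of_pos (by positivity)]
    calc (2:ℝ)^n * _ ≤ 2^n * (C * (‖w‖ * ‖w‖)) := by gcongr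
      _ = C * ‖u‖^2 * (1/2)^n * ((1/2)^n * 2^n) / 4 := by rw [hwn, pow_succ]; ring
      _ = C * ‖u‖^2 * (1/2)^n / 4 := by rw [h12]; ring
      _ ≤ C * ‖u‖^2 * (1/2)^n / 2 := by
        have : 0 ≤ C * ‖u‖^2 * (1/2)^n := by positivity
        linarith
      _ = (C * ‖u‖^2) / 2 / 2^n := by rw [one_div, inv_pow]; ring
  have hlim0 : ∀ u : E, ‖u‖ < r → ∃ l, Tendsto (q u) atTop (𝓝 l) := fun u hu =>
    cauchySeq_tendsto_of_complete (cauchySeq_of_le_geometric_two (hstep u hu))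
  have hsmall : ∀ u : E, ∀ᶠ n : ℕ in atTop, ‖((1/2:ℝ)^n) • u‖ < r := by
    intro u
    have : Tendsto (fun n : ℕ => ((1:ℝ)/2)^n * ‖u‖) atTop (𝓝 0) := by
      simpa using (tendsto_pow_atTop_nhds_zero_of_lt_one (r := (1/2:ℝ)) (by norm_num)
        (by norm_num)).mul_const ‖u‖
    filter_upwards [this.eventually_lt_const hr] with n hn
    rwa [hsc]
  have hlim : ∀ u : E, ∃ l, Tendsto (q u) atTop (𝓝 l) := by
    intro u
    obtain ⟨N, hN⟩ := (hsmall u).exists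
    obtain ⟨l, hl⟩ := hlim0 _ hN
    refine ⟨2^N * l, ?_⟩
    rw [← tendsto_add_atTop_iff_nat N]
    refine (hl.const_mul (2^N)).congr fun n => ?_
    simp only [q]
    rw [smul_smul, ← pow_add, pow_add 2]; ring
  choose g hg using hlim
  have hadd : ∀ u v, g (u + v) = g u + g v := by
    intro u v
    have t1 : Tendsto (fun n => q (u + v) n - (q u n + q v n)) atTop (𝓝 (g (u+v) - (g u + g v))) :=
      (hg _).sub ((hg u).add (hg v))
    have t2 : Tendsto (fun n => q (u + v) n - (q u n + q v n)) atTop (𝓝 0) := by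
      have t3 : Tendsto (fun n : ℕ => C * (‖u‖ * ‖v‖) * ((1:ℝ)/2)^n) atTop (𝓝 0) := by
        simpa using (tendsto_pow_atTop_nhds_zero_of_lt_one (r := (1/2:ℝ)) (by norm_num)
          (by norm_num)).const_mul (C * (‖u‖ * ‖v‖))
      refine squeeze_zero_norm' ?_ t3
      filter_upwards [hsmall u, hsmall v, hsmall (u + v)] with n h1 h2 h3
      have := h.two (x := c) (u := ((1/2:ℝ)^n) • u) (v := ((1/2:ℝ)^n) • v) (by simpa using hr)
        (hb _ h1) (hb _ h2) (by rw [add_assoc, ← smul_add]; exact hb _ h3)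
      have e : q (u + v) n - (q u n + q v n) = 2^n * (f (c + ((1/2:ℝ)^n) • u + ((1/2:ℝ)^n) • v)
          - f (c + ((1/2:ℝ)^n) • u) - (f (c + ((1/2:ℝ)^n) • v) - f c)) := by
        simp only [q]; rw [smul_add, ← add_assoc]; ring
      rw [e, Real.norm_eq_abs, abs_mul, abs_of_pos (by positivity)]
      calc (2:ℝ)^n * _ ≤ 2^n * (C * (‖((1/2:ℝ)^n) • u‖ * ‖((1/2:ℝ)^n) • v‖)) := by gcongr
        _ = C * (‖u‖ * ‖v‖) * (1/2)^n * ((1/2)^n * 2^n) := by rw [hsc, hsc]; ring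
        _ = _ := by rw [h12]; ring
    have := tendsto_nhds_unique t1 t2
    linarith
  have happrox : ∀ u : E, ‖u‖ < r → |f (c + u) - f c - g u| ≤ C * ‖u‖^2 := by
    intro u hu
    have := dist_le_of_le_geometric_two_of_tendsto₀ (hstep u hu) (hg u)
    rw [Real.dist_eq] at this
    simpa [q, -sub_sub, -tsub_le_iff_right] using this
  let G : E →+ ℝ := AddMonoidHom.mk' g hadd
  have hnear : ∀ᶠ u : E in 𝓝 0, ‖u‖ < r := by
    have := Metric.ball_mem_nhds (0:E) hr
    filter_upwards [this] with u hu
    simpa using hu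
  have hG : Continuous G := by
    refine continuous_of_continuousAt_zero G ?_
    have hG0 : G 0 = 0 := map_zero G
    unfold ContinuousAt
    rw [hG0]
    have t : Tendsto (fun u : E => |f (c + u) - f c| + C * ‖u‖^2) (𝓝 0) (𝓝 0) := by
      have hc : ContinuousAt (fun u : E => f (c + u)) 0 := by
        refine ContinuousAt.comp (g := f) (by simpa using hf) (by fun_prop)
      have : ContinuousAt (fun u : E => |f (c + u) - f c| + C * ‖u‖^2) 0 :=
        (hc.sub continuousAt_const).abs.add (by fun_prop)
      simpa [ContinuousAt] using this
    refine squeeze_zero_norm' ?_ t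
    filter_upwards [hnear] with u hu
    have a := happrox u hu
    change |g u| ≤ _
    have := abs_sub (f (c + u) - f c) (f (c + u) - f c - g u)
    rw [sub_sub_cancel] at this
    linarith
  refine ⟨G.toRealLinearMap hG, ?_⟩
  rw [hasFDerivAt_iff_isLittleO_nhds_zero]
  have hO : (fun u : E => f (c + u) - f c - (G.toRealLinearMap hG) u) =O[𝓝 0] fun u => ‖u‖^2 := by
    refine Asymptotics.IsBigO.of_bound C ?_
    filter_upwards [hnear] with u hu
    have := happrox u hu
    simpa [G] using this
  refine hO.trans_isLittleO ?_
  exact Asymptotics.isLittleO_norm_pow_id one_lt_two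

lemma core {S : Set E} (hS : IsOpen S) {f : E → ℝ} (hf : ContinuousOn f S) {j : ℕ} {C : ℝ}
    (hC : 0 ≤ C) (h : BD (j+2) C S f) {c : E} (hc : c ∈ S) :
    DifferentiableAt ℝ f c ∧ ∀ v, ContinuousAt (fun y => fderiv ℝ f y v) c := by
  have hfc : ∀ y ∈ S, ContinuousAt f y := fun y hy => hf.continuousAt (hS.mem_nhds hy)
  have h1 : ∀ᶠ y in nhds c, |f y| ≤ |f c| + 1 := by
    have := (hfc c hc).abs.eventually_lt_const (show |f c| < |f c| + 1 by linarith)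
    filter_upwards [this] with y hy using hy.le
  obtain ⟨r, hr, hr2⟩ := Metric.eventually_nhds_iff_ball.1 (h1.and (hS.mem_nhds hc))
  have hsub : Metric.ball c r ⊆ S := fun y hy => (hr2 y hy).2
  obtain ⟨r', hr', hle, C', hC', h2⟩ := down_to_two j r c f _ C hr (by positivity) hC
    (fun y hy => (hr2 y hy).1) (h.mono hsub)
  have hsub' : Metric.ball c r' ⊆ S := (Metric.ball_subset_ball hle).trans hsub
  have hd : ∀ y ∈ Metric.ball c r', DifferentiableAt ℝ f y := by
    intro y hy
    obtain ⟨ε, hε, hε2⟩ := Metric.isOpen_iff.1 Metric.isOpen_ball y hy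
    exact differentiableAt_of_two hε hC' (hfc y (hsub' hy)) (h2.mono hε2)
  refine ⟨hd c (Metric.mem_ball_self hr'), fun v => ?_⟩
  exact (BD.continuousOn (by positivity) (h2.fderiv hC' Metric.isOpen_ball hd v)).continuousAt
    (Metric.ball_mem_nhds c hr')

lemma iter_apply {S : Set E} (hS : UniqueDiffOn ℝ S) {n : ℕ} {f : E → ℝ}
    (hf : ContDiffOn ℝ n (fderivWithin ℝ f S) S) {x : E} (hx : x ∈ S) (v : E) (m : Fin n → E) :
    iteratedFDerivWithin ℝ n (fun y => fderivWithin ℝ f S y v) S x m =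
      iteratedFDerivWithin ℝ (n+1) f S x (Fin.snoc m v : Fin (n+1) → E) := by
  rw [iteratedFDerivWithin_succ_apply_right hS hx]
  have := (ContinuousLinearMap.apply ℝ ℝ v).iteratedFDerivWithin_comp_left (hf x hx) hS hx
    (i := n) le_rfl
  have e : (fun y => fderivWithin ℝ f S y v) =
    (ContinuousLinearMap.apply ℝ ℝ v) ∘ (fderivWithin ℝ f S) := rfl
  rw [e, this]
  simp

lemma forward [FiniteDimensional ℝ E] {S : Set E} (hS : IsOpen S) (n : ℕ) :
    ∀ (f : E → ℝ) (C : NNReal), ContinuousOn f S → BD (n+1) C S f →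
      ContDiffOn ℝ n f S ∧ LipschitzOnWith C (iteratedFDerivWithin ℝ n f S) S := by
  induction n with
  | zero =>
    intro f C hf h
    refine ⟨by simpa using hf, LipschitzOnWith.of_dist_le_mul fun x hx y hy => ?_⟩
    have := h.cons (v := x - y) (u := Fin.elim0) (x := y) (by intro α; simpa using hx)
      (by intro α; simpa using hy)
    simp only [fdiff_zero] at this
    rw [iteratedFDerivWithin_zero_eq_comp]
    simp only [Function.comp_apply, LinearIsometryEquiv.dist_map]
    simpa [dist_eq_norm] using this
  | succ n ih =>
    intro f C hf h
    have hco := fun c hc => core (c := c) hS hf C.2 h hc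
    have hd : ∀ y ∈ S, DifferentiableAt ℝ f y := fun y hy => (hco y hy).1
    have hv : ∀ v : E, ContDiffOn ℝ n (fun y => fderivWithin ℝ f S y v) S ∧
        LipschitzOnWith (C * ‖v‖₊)
          (iteratedFDerivWithin ℝ n (fun y => fderivWithin ℝ f S y v) S) S := by
      intro v
      have heq : ∀ y ∈ S, fderiv ℝ f y v = fderivWithin ℝ f S y v := fun y hy => by
        rw [fderivWithin_of_isOpen hS hy]
      refine ih _ _ ?_ ?_
      · refine ContinuousOn.congr (f := fun y => fderiv ℝ f y v) ?_ (fun y hy => (heq y hy).symm)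
        exact fun y hy => ((hco y hy).2 v).continuousWithinAt
      · have := h.fderiv C.2 hS hd v
        exact (BD.congr this heq)
    have hcd : ContDiffOn ℝ n (fderivWithin ℝ f S) S := contDiffOn_clm_apply.2 fun v => (hv v).1
    refine ⟨?_, ?_⟩
    · rw [Nat.cast_add, Nat.cast_one, contDiffOn_succ_iff_fderivWithin hS.uniqueDiffOn]
      refine ⟨fun y hy => (hd y hy).differentiableWithinAt, by simp, hcd⟩
    · refine LipschitzOnWith.of_dist_le_mul fun x hx y hy => ?_
      rw [dist_eq_norm]
      refine ContinuousMultilinearMap.opNorm_le_bound (by positivity) fun m => ?_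
      obtain ⟨m', v, rfl⟩ : ∃ m' v, m = Fin.snoc m' v :=
        ⟨Fin.init m, m (Fin.last n), (Fin.snoc_init_self m).symm⟩
      rw [sub_apply, ← iter_apply hS.uniqueDiffOn hcd hx,
        ← iter_apply hS.uniqueDiffOn hcd hy, ← sub_apply]
      refine (ContinuousMultilinearMap.le_opNorm _ _).trans ?_
      have l := (hv v).2.dist_le_mul x hx y hy
      rw [dist_eq_norm] at l
      rw [Fin.prod_univ_castSucc]
      simp only [Fin.snoc_castSucc, Fin.snoc_last]
      refine (mul_le_mul_of_nonneg_right l (by positivity)).trans_eq ?_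
      push_cast
      ring

lemma backward {S : Set E} (hS : IsOpen S) (hconv : Convex ℝ S) (n : ℕ) :
    ∀ (f : E → ℝ) (C : NNReal), ContDiffOn ℝ n f S →
      LipschitzOnWith C (iteratedFDerivWithin ℝ n f S) S → BD (n+1) C S f := by
  induction n with
  | zero =>
    intro f C _ hl
    refine BD.of_cons fun v u x h1 h2 => ?_
    have := hl.dist_le_mul _ h1.base _ h2.base
    rw [iteratedFDerivWithin_zero_eq_comp] at this
    simp only [Function.comp_apply, LinearIsometryEquiv.dist_map] at this
    simpa [fdiff_zero, dist_eq_norm] using this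
  | succ n ih =>
    intro f C hf hl
    rw [Nat.cast_add, Nat.cast_one, contDiffOn_succ_iff_fderivWithin hS.uniqueDiffOn] at hf
    obtain ⟨hd, -, hcd⟩ := hf
    have hd' : ∀ y ∈ S, DifferentiableAt ℝ f y := fun y hy => (hd y hy).differentiableAt
      (hS.mem_nhds hy)
    refine BD.of_cons fun v u x h1 h2 => ?_
    have hB : BD (n+1) (C * ‖v‖₊ : NNReal) S (fun y => fderivWithin ℝ f S y v) := by
      refine ih _ _ (hcd.clm_apply contDiffOn_const) ?_
      refine LipschitzOnWith.of_dist_le_mul fun x hx y hy => ?_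
      rw [dist_eq_norm]
      refine ContinuousMultilinearMap.opNorm_le_bound (by positivity) fun m => ?_
      rw [sub_apply, iter_apply hS.uniqueDiffOn hcd hx,
        iter_apply hS.uniqueDiffOn hcd hy, ← sub_apply]
      refine (ContinuousMultilinearMap.le_opNorm _ _).trans ?_
      have l := hl.dist_le_mul x hx y hy
      rw [dist_eq_norm] at l
      rw [Fin.prod_univ_castSucc]
      simp only [Fin.snoc_castSucc, Fin.snoc_last]
      refine (mul_le_mul_of_nonneg_right l (by positivity)).trans_eq ?_
      push_cast
      ring
    have hB' : BD (n+1) (C * ‖v‖₊ : NNReal) S (fun y => fderiv ℝ f y v) :=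
      hB.congr fun y hy => by rw [fderivWithin_of_isOpen hS hy]
    have hcube : ∀ t ∈ Set.Icc (0:ℝ) 1, Cube u (x + t • v) S := by
      intro t ht α
      have := hconv (h2 α) (h1 α) (a := 1 - t) (b := t) (by linarith [ht.2]) ht.1 (by ring)
      convert this using 1
      module
    have := (convex_Icc (0:ℝ) 1).norm_image_sub_le_of_norm_hasDerivWithin_le
      (f := fun s : ℝ => fdiff u f (x + s • v))
      (f' := fun t => fdiff u (fun y => fderiv ℝ f y v) (x + t • v))
      (C := (C * ‖v‖₊ : NNReal) * ∏ i, ‖u i‖) (x := 0) (y := 1)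
      (fun t ht => (hasDerivAt_fdiff hd' (hcube t ht)).hasDerivWithinAt)
      (fun t ht => hB' u _ (hcube t ht)) (by simp) (by simp)
    simp at this
    refine this.trans_eq ?_
    ring

end

/-- Theorem B: on an open convex set, a continuous function has `k`-th finite differences
bounded by `C` iff it is `C^{k-1}` with `(k-1)`-th derivative `C`-Lipschitz. -/
theorem lipschitz_class_iff_bounded_differences {d : ℕ}
    (Ω : Set (EuclideanSpace ℝ (Fin d))) (hΩ : IsOpen Ω) (hconv : Convex ℝ Ω)
    {k : ℕ} (hk : 1 ≤ k) (f : EuclideanSpace ℝ (Fin d) → ℝ)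
    (hf : ContinuousOn f Ω) (C : NNReal) :
    (∀ (u : Fin k → EuclideanSpace ℝ (Fin d)) (x : EuclideanSpace ℝ (Fin d)),
        (∀ α : Fin k → Bool, x + ∑ i, (if α i then u i else 0) ∈ Ω) →
        ‖fdiff u f x‖ ≤ C * ∏ i, ‖u i‖) ↔
      ContDiffOn ℝ (k - 1 : ℕ) f Ω ∧
        LipschitzOnWith C (iteratedFDerivWithin ℝ (k - 1) f Ω) Ω := by
  obtain ⟨n, rfl⟩ : ∃ n, k = n + 1 := ⟨k - 1, by omega⟩
  exact ⟨fun h => forward hΩ n f C hf h, fun h => backward hΩ hconv n f C h.1 h.2⟩
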